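/- For s = d there exists a Borel set E ⊆ ℝ^d of Hausdorff dimension d that is mid-point convex but not essentially convex and satisfies H^d(E) = 0. -/

import Mathlib

open MeasureTheory Set Metric Filter
open scoped ENNReal

/-- A set `E ⊆ ℝ^d` is mid-point convex if the midpoint of any two of its points
belongs to it. -/
def MidpointConvexSet {d : ℕ} (E : Set (EuclideanSpace ℝ (Fin d))) : Prop :=
  ∀ x ∈ E, ∀ y ∈ E, midpoint ℝ x y ∈ E

/-- A set `E ⊆ ℝ^d` is essentially convex if there are an integer `1 ≤ s ≤ d` and an affine
subspace `L` of dimension `s` containing `E` such that, in the subspace topology of `L`,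
`E` has nonempty interior and `convexHull E \ E` lies in the frontier of `convexHull E`. -/
def EssentiallyConvex {d : ℕ} (E : Set (EuclideanSpace ℝ (Fin d))) : Prop :=
  ∃ s : ℕ, 1 ≤ s ∧ s ≤ d ∧
    ∃ L : AffineSubspace ℝ (EuclideanSpace ℝ (Fin d)),
      Module.finrank ℝ L.direction = s ∧
      E ⊆ (L : Set (EuclideanSpace ℝ (Fin d))) ∧
      (interior ((Subtype.val : L → EuclideanSpace ℝ (Fin d)) ⁻¹' E)).Nonempty ∧
      (Subtype.val : L → EuclideanSpace ℝ (Fin d)) ⁻¹' (convexHull ℝ E \ E) ⊆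
        frontier ((Subtype.val : L → EuclideanSpace ℝ (Fin d)) ⁻¹' (convexHull ℝ E))

/-- The reals that, at every scale `2 ^ -(k ^ 3 + k ^ 2)`, lie very close to the dyadic grid which
is `2 ^ m` times finer than this scale. -/
def nearDyadic (m : ℕ) : Set ℝ :=
  {x | ∀ k : ℕ, ∃ n : ℤ, |x - n / 2 ^ (m + (k ^ 3 + k ^ 2))| ≤ 1 / 2 ^ (k + (k ^ 3 + k ^ 2))}

theorem nearDyadic_mono : Monotone nearDyadic := by
  refine monotone_nat_of_le_succ fun m x hx k => ?_
  obtain ⟨n, hn⟩ := hx k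
  refine ⟨2 * n, ?_⟩
  have h : ((2 * n : ℤ) : ℝ) / 2 ^ (m + 1 + (k ^ 3 + k ^ 2)) = n / 2 ^ (m + (k ^ 3 + k ^ 2)) := by
    rw [add_right_comm, pow_succ]
    push_cast
    field_simp
  rwa [h]

theorem midpoint_mem_nearDyadic_succ {m : ℕ} {x y : ℝ} (hx : x ∈ nearDyadic m)
    (hy : y ∈ nearDyadic m) : midpoint ℝ x y ∈ nearDyadic (m + 1) := by
  intro k
  obtain ⟨n, hn⟩ := hx k
  obtain ⟨n', hn'⟩ := hy k
  refine ⟨n + n', ?_⟩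
  have h : midpoint ℝ x y - ((n + n' : ℤ) : ℝ) / 2 ^ (m + 1 + (k ^ 3 + k ^ 2)) =
      ((x - n / 2 ^ (m + (k ^ 3 + k ^ 2))) + (y - n' / 2 ^ (m + (k ^ 3 + k ^ 2)))) / 2 := by
    rw [midpoint_eq_smul_add, add_right_comm, pow_succ, smul_eq_mul, invOf_eq_inv]
    push_cast
    field_simp
    ring
  rw [h, abs_div, abs_two, div_le_iff₀ two_pos]
  exact (abs_add_le _ _).trans (by linarith)

theorem measurableSet_nearDyadic (m : ℕ) : MeasurableSet (nearDyadic m) := by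
  have h : nearDyadic m = ⋂ k : ℕ, ⋃ n : ℤ,
      closedBall ((n : ℝ) / 2 ^ (m + (k ^ 3 + k ^ 2))) (1 / 2 ^ (k + (k ^ 3 + k ^ 2))) := by
    ext x
    simp [nearDyadic, Real.dist_eq]
  rw [h]
  exact .iInter fun _ => .iUnion fun _ => measurableSet_closedBall

theorem volume_nearDyadic_inter_closedBall_le (m R k : ℕ) :
    volume (nearDyadic m ∩ closedBall 0 R) ≤ ENNReal.ofReal (6 * (R + 1) * 2 ^ m / 2 ^ k) := by
  set b := k ^ 3 + k ^ 2
  set N : ℕ := (R + 1) * 2 ^ (m + b) with hN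
  have hsub : nearDyadic m ∩ closedBall 0 R ⊆
      ⋃ n ∈ Finset.Icc (-N : ℤ) N, closedBall ((n : ℝ) / 2 ^ (m + b)) (1 / 2 ^ (k + b)) := by
    rintro x ⟨hx, hxR⟩
    obtain ⟨n, hn⟩ := hx k
    simp only [mem_iUnion, mem_closedBall, Real.dist_eq]
    refine ⟨n, ?_, hn⟩
    rw [mem_closedBall, Real.dist_eq, sub_zero] at hxR
    have h1 : (1 : ℝ) / 2 ^ (k + b) ≤ 1 := by
      rw [div_le_one (by positivity)]
      exact one_le_pow₀ one_le_two
    have h2 : |(n : ℝ) / 2 ^ (m + b)| ≤ R + 1 := by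
      have := abs_sub_abs_le_abs_sub ((n : ℝ) / 2 ^ (m + b)) x
      rw [abs_sub_comm] at this
      linarith
    rw [abs_div, abs_of_pos (by positivity : (0 : ℝ) < 2 ^ (m + b)),
      div_le_iff₀ (by positivity)] at h2
    have h3 : |n| ≤ (N : ℤ) := by
      rw [hN]
      exact_mod_cast h2
    rw [Finset.mem_Icc]
    exact abs_le.mp h3
  refine (measure_mono hsub).trans ((measure_biUnion_finset_le _ _).trans ?_)
  simp only [Real.volume_closedBall, Finset.sum_const, Int.card_Icc, nsmul_eq_mul]
  rw [← ENNReal.ofReal_natCast, ← ENNReal.ofReal_mul (by positivity)]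
  refine ENNReal.ofReal_le_ofReal ?_
  have hc : ((N + 1 - -N : ℤ).toNat : ℝ) ≤ 3 * N := by
    have h1 : 1 ≤ N := Nat.one_le_iff_ne_zero.mpr (by positivity)
    exact_mod_cast (by lia : (N + 1 - -N : ℤ).toNat ≤ 3 * N)
  calc _ ≤ 3 * (N : ℝ) * (2 * (1 / 2 ^ (k + b))) := by gcongr
    _ = _ := by
      rw [hN]
      push_cast
      rw [pow_add, pow_add]
      field_simp
      ring

theorem volume_nearDyadic (m : ℕ) : volume (nearDyadic m) = 0 := by
  have hcov : nearDyadic m = ⋃ R : ℕ, nearDyadic m ∩ closedBall 0 R := by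
    rw [← inter_iUnion, iUnion_closedBall_nat, inter_univ]
  rw [hcov, measure_iUnion_null_iff]
  intro R
  refine le_antisymm (ge_of_tendsto' (x := atTop) ?_
    (volume_nearDyadic_inter_closedBall_le m R)) zero_le
  rw [← ENNReal.ofReal_zero]
  refine ENNReal.tendsto_ofReal ?_
  simpa using ((tendsto_pow_atTop_nhds_zero_of_lt_one (by norm_num : (0 : ℝ) ≤ 2⁻¹)
    (by norm_num)).const_mul (6 * ((R : ℝ) + 1) * 2 ^ m)).congr fun k => by
      rw [inv_pow, div_eq_mul_inv]

/-- The partial sums `∑ j < k, a j / 2 ^ ((j + 1) ^ 3 + (j + 1) ^ 2)`, where the `a j` are the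
digits of `t` in the expansion `t = ∑ j, a j / 2 ^ ((j + 1) ^ 3)`. -/
noncomputable def spreadPartial (t : ℝ) : ℕ → ℝ
  | 0 => 0
  | k + 1 => spreadPartial t k +
      (⌊2 ^ ((k + 1) ^ 3) * t⌋ - 2 ^ (3 * k ^ 2 + 3 * k + 1) * ⌊2 ^ (k ^ 3) * t⌋ : ℝ) /
        2 ^ ((k + 1) ^ 3 + (k + 1) ^ 2)

theorem exists_spreadPartial_eq_div (t : ℝ) (k : ℕ) :
    ∃ n : ℤ, spreadPartial t k = n / 2 ^ (k ^ 3 + k ^ 2) := by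
  induction k with
  | zero => exact ⟨0, by simp [spreadPartial]⟩
  | succ k ih =>
    obtain ⟨n, hn⟩ := ih
    refine ⟨n * 2 ^ (3 * k ^ 2 + 5 * k + 2) + (⌊2 ^ ((k + 1) ^ 3) * t⌋ -
      2 ^ (3 * k ^ 2 + 3 * k + 1) * ⌊2 ^ (k ^ 3) * t⌋), ?_⟩
    have h : (k + 1) ^ 3 + (k + 1) ^ 2 = (k ^ 3 + k ^ 2) + (3 * k ^ 2 + 5 * k + 2) := by ring
    rw [spreadPartial, hn, h]
    push_cast
    rw [pow_add _ (k ^ 3 + k ^ 2)]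
    field_simp

theorem digit_nonneg (t : ℝ) (k : ℕ) :
    (0 : ℝ) ≤ ⌊2 ^ ((k + 1) ^ 3) * t⌋ - 2 ^ (3 * k ^ 2 + 3 * k + 1) * ⌊2 ^ (k ^ 3) * t⌋ := by
  have h : (k + 1) ^ 3 = (3 * k ^ 2 + 3 * k + 1) + k ^ 3 := by ring
  rw [sub_nonneg]
  have : 2 ^ (3 * k ^ 2 + 3 * k + 1) * ⌊(2 : ℝ) ^ (k ^ 3) * t⌋ ≤
      ⌊(2 : ℝ) ^ ((k + 1) ^ 3) * t⌋ := by
    rw [Int.le_floor, h, pow_add _ _ (k ^ 3), mul_assoc]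
    push_cast
    exact mul_le_mul_of_nonneg_left (Int.floor_le _) (by positivity)
  exact_mod_cast this

theorem digit_le (t : ℝ) (k : ℕ) :
    (⌊2 ^ ((k + 1) ^ 3) * t⌋ - 2 ^ (3 * k ^ 2 + 3 * k + 1) * ⌊2 ^ (k ^ 3) * t⌋ : ℝ) ≤
      2 ^ (3 * k ^ 2 + 3 * k + 1) := by
  have h : (k + 1) ^ 3 = (3 * k ^ 2 + 3 * k + 1) + k ^ 3 := by ring
  calc _ ≤ 2 ^ (3 * k ^ 2 + 3 * k + 1) * (2 ^ (k ^ 3) * t) -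
        2 ^ (3 * k ^ 2 + 3 * k + 1) * ⌊2 ^ (k ^ 3) * t⌋ := by
        gcongr
        rw [h, pow_add, mul_assoc]
        exact Int.floor_le _
    _ = 2 ^ (3 * k ^ 2 + 3 * k + 1) * (2 ^ (k ^ 3) * t - ⌊2 ^ (k ^ 3) * t⌋) := by ring
    _ ≤ 2 ^ (3 * k ^ 2 + 3 * k + 1) * 1 := by
        gcongr
        linarith [Int.lt_floor_add_one (2 ^ (k ^ 3) * t)]
    _ = _ := mul_one _

theorem spreadPartial_mono (t : ℝ) : Monotone (spreadPartial t) :=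
  monotone_nat_of_le_succ fun k =>
    le_add_of_nonneg_right (div_nonneg (digit_nonneg t k) (by positivity))

theorem spreadPartial_add_antitone (t : ℝ) :
    Antitone fun k => spreadPartial t k + 1 / 2 ^ (k + (k ^ 3 + k ^ 2)) := by
  refine antitone_nat_of_succ_le fun k => ?_
  have h1 : (⌊2 ^ ((k + 1) ^ 3) * t⌋ - 2 ^ (3 * k ^ 2 + 3 * k + 1) * ⌊2 ^ (k ^ 3) * t⌋ : ℝ) /
        2 ^ ((k + 1) ^ 3 + (k + 1) ^ 2) ≤ 1 / 2 ^ (k + 1 + (k ^ 3 + k ^ 2)) := by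
    rw [div_le_div_iff₀ (by positivity) (by positivity), one_mul]
    calc _ ≤ (2 : ℝ) ^ (3 * k ^ 2 + 3 * k + 1) * 2 ^ (k + 1 + (k ^ 3 + k ^ 2)) := by
          gcongr
          exact digit_le t k
      _ ≤ _ := by
          rw [← pow_add]
          exact pow_le_pow_right₀ one_le_two (by ring_nf; lia)
  have h2 : (1 : ℝ) / 2 ^ (k + 1 + ((k + 1) ^ 3 + (k + 1) ^ 2)) ≤
      1 / 2 ^ (k + 1 + (k ^ 3 + k ^ 2)) := by
    gcongr
    · exact one_le_two
    · lia
    · lia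
  have h3 : (1 : ℝ) / 2 ^ (k + (k ^ 3 + k ^ 2)) = 2 * (1 / 2 ^ (k + 1 + (k ^ 3 + k ^ 2))) := by
    rw [add_right_comm k 1, pow_succ 2 (k + _)]
    field_simp
  simp only [spreadPartial]
  linarith

/-- The digits of `t` in the expansion `t = ∑ j, a j / 2 ^ ((j + 1) ^ 3)`, separated by long
blocks of zeros. -/
noncomputable def spread (t : ℝ) : ℝ := ⨆ k, spreadPartial t k

theorem spread_mem_Icc (t : ℝ) (k : ℕ) :
    spread t ∈ Icc (spreadPartial t k)
      (spreadPartial t k + 1 / 2 ^ (k + (k ^ 3 + k ^ 2))) :=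
  mem_iInter.mp ((spreadPartial_mono t).ciSup_mem_iInter_Icc_of_antitone
    (spreadPartial_add_antitone t) fun _ => le_add_of_nonneg_right (by positivity)) k

theorem spread_mem_nearDyadic_zero (t : ℝ) : spread t ∈ nearDyadic 0 := by
  intro k
  obtain ⟨n, hn⟩ := exists_spreadPartial_eq_div t k
  have h := spread_mem_Icc t k
  refine ⟨n, ?_⟩
  rw [zero_add, ← hn, abs_of_nonneg (by linarith [h.1])]
  linarith [h.2]

theorem tendsto_spreadPartial (t : ℝ) : Tendsto (spreadPartial t) atTop (nhds (spread t)) :=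
  tendsto_atTop_ciSup (spreadPartial_mono t)
    ⟨spread t, by rintro _ ⟨k, rfl⟩; exact (spread_mem_Icc t k).1⟩

theorem floor_sub_le_spread_sub {t u : ℝ} (ht : 0 ≤ t) (htu : t ≤ u) (hu : u < 1) (k : ℕ) :
    (⌊2 ^ (k ^ 3) * u⌋ - ⌊2 ^ (k ^ 3) * t⌋ : ℝ) / 2 ^ (k ^ 3 + k ^ 2) / 2 ≤
      spread u - spread t := by
  set F : ℕ → ℝ := fun k => ⌊2 ^ (k ^ 3) * u⌋ - ⌊2 ^ (k ^ 3) * t⌋ with hF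
  have hF0 : ∀ k, 0 ≤ F k := fun k => by
    rw [hF, sub_nonneg, Int.cast_le]
    gcongr
  set D : ℕ → ℝ := fun k => spreadPartial u k - spreadPartial t k - F k / 2 ^ (k ^ 3 + k ^ 2)
    with hD
  have hstep : ∀ k, D k + F k / 2 ^ (k ^ 3 + k ^ 2) / 2 ≤ D (k + 1) := by
    intro k
    have h1 : D (k + 1) = D k + F k / 2 ^ (k ^ 3 + k ^ 2) * (1 - 1 / 2 ^ (2 * k + 1)) := by
      have h : (k + 1) ^ 3 + (k + 1) ^ 2 =
        (k ^ 3 + k ^ 2) + ((3 * k ^ 2 + 3 * k + 1) + (2 * k + 1)) := by ring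
      simp only [hD, hF, spreadPartial]
      rw [h, pow_add _ (k ^ 3 + k ^ 2), pow_add _ (3 * k ^ 2 + 3 * k + 1)]
      field_simp
      ring
    have h2 : (1 : ℝ) / 2 ^ (2 * k + 1) ≤ 1 / 2 := by
      gcongr
      exact le_self_pow₀ one_le_two (by lia)
    have h3 : 0 ≤ F k / 2 ^ (k ^ 3 + k ^ 2) := div_nonneg (hF0 k) (by positivity)
    rw [h1]
    nlinarith
  have hD0 : D 0 = 0 := by
    have h1 : ⌊u⌋ = 0 := Int.floor_eq_zero_iff.mpr ⟨ht.trans htu, hu⟩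
    have h2 : ⌊t⌋ = 0 := Int.floor_eq_zero_iff.mpr ⟨ht, htu.trans_lt hu⟩
    simp [hD, hF, spreadPartial, h1, h2]
  have hmono : Monotone D := monotone_nat_of_le_succ fun k => by
    have : 0 ≤ F k / 2 ^ (k ^ 3 + k ^ 2) / 2 := by have := hF0 k; positivity
    linarith [hstep k]
  refine ge_of_tendsto ((tendsto_spreadPartial u).sub (tendsto_spreadPartial t)) ?_
  filter_upwards [eventually_ge_atTop (k + 1)] with K hK
  have h1 := hmono hK
  have h2 := hmono (Nat.zero_le k)
  have h3 := hstep k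
  have h4 : 0 ≤ F K / 2 ^ (K ^ 3 + K ^ 2) := div_nonneg (hF0 K) (by positivity)
  have h5 : D K = spreadPartial u K - spreadPartial t K - F K / 2 ^ (K ^ 3 + K ^ 2) := rfl
  change F k / 2 ^ (k ^ 3 + k ^ 2) / 2 ≤ _
  linarith

theorem exists_succ_sq_le_mul_cube_add {δ : ℝ} (hδ : 0 < δ) :
    ∃ C : ℝ, ∀ j : ℕ, ((j : ℝ) + 1) ^ 2 ≤ δ * (j : ℝ) ^ 3 + C := by
  refine ⟨(4 / δ + 2) ^ 2, fun j => ?_⟩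
  have hj : (0 : ℝ) ≤ j := j.cast_nonneg
  rcases le_total (j : ℝ) (4 / δ + 1) with h | h
  · have : ((j : ℝ) + 1) ^ 2 ≤ (4 / δ + 2) ^ 2 := by
      gcongr ?_ ^ 2
      linarith
    have : 0 ≤ δ * (j : ℝ) ^ 3 := by positivity
    linarith
  · have h1 : 4 ≤ δ * j := by
      have := mul_le_mul_of_nonneg_left h hδ.le
      rw [mul_add, mul_div_cancel₀ _ hδ.ne'] at this
      linarith
    have h2 : (1 : ℝ) ≤ j := by linarith [show 0 < 4 / δ by positivity]
    have h3 : 4 * (j : ℝ) ^ 2 ≤ δ * j * (j : ℝ) ^ 2 := by gcongr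
    nlinarith [sq_nonneg (4 / δ + 2)]

theorem exists_mul_rpow_le_spread_sub {δ : ℝ} (hδ : 0 < δ) :
    ∃ c > 0, ∀ t u : ℝ, 0 ≤ t → t < u → u < 1 →
      c * (u - t) ^ (1 + δ) ≤ spread u - spread t := by
  obtain ⟨C, hC⟩ := exists_succ_sq_le_mul_cube_add hδ
  refine ⟨2 ^ (-(C + δ + 2)), by positivity, fun t u ht htu hu => ?_⟩
  have hpos : 0 < u - t := sub_pos.mpr htu
  have hex : ∃ k : ℕ, 2 ≤ 2 ^ (k ^ 3) * (u - t) := by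
    obtain ⟨k, hk⟩ := pow_unbounded_of_one_lt (2 / (u - t)) one_lt_two
    refine ⟨k, ?_⟩
    rw [← div_le_iff₀ hpos]
    exact hk.le.trans (pow_le_pow_right₀ one_le_two (Nat.le_self_pow (by lia) k))
  obtain ⟨k, hk, hmin⟩ : ∃ k : ℕ, 2 ≤ 2 ^ (k ^ 3) * (u - t) ∧
      ∀ j < k, ¬ 2 ≤ 2 ^ (j ^ 3) * (u - t) :=
    ⟨Nat.find hex, Nat.find_spec hex, fun _ => Nat.find_min hex⟩
  obtain _ | j := k
  · norm_num at hk
    linarith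
  have hj := not_le.mp (hmin j (Nat.lt_succ_self j))
  have hfloor : 2 ^ ((j + 1) ^ 3) * (u - t) / 2 ≤
      (⌊2 ^ ((j + 1) ^ 3) * u⌋ - ⌊2 ^ ((j + 1) ^ 3) * t⌋ : ℝ) := by
    have h1 := Int.lt_floor_add_one (2 ^ ((j + 1) ^ 3) * u)
    have h2 := Int.floor_le (2 ^ ((j + 1) ^ 3) * t)
    linarith
  have hscale : (2 : ℝ) ^ (-(C + δ)) * (u - t) ^ δ ≤ 1 / 2 ^ ((j + 1) ^ 2) := by
    have h1 : u - t ≤ (2 : ℝ) ^ (1 - (j : ℝ) ^ 3) := by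
      rw [Real.rpow_sub two_pos, Real.rpow_one, le_div_iff₀ (by positivity)]
      have : (2 : ℝ) ^ ((j : ℝ) ^ 3) = 2 ^ (j ^ 3) := by
        exact_mod_cast Real.rpow_natCast 2 (j ^ 3)
      rw [this]
      linarith
    calc (2 : ℝ) ^ (-(C + δ)) * (u - t) ^ δ
        ≤ 2 ^ (-(C + δ)) * (2 ^ (1 - (j : ℝ) ^ 3)) ^ δ := by gcongr
      _ = 2 ^ (-(δ * (j : ℝ) ^ 3 + C)) := by
          rw [← Real.rpow_mul two_pos.le, ← Real.rpow_add two_pos]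
          ring_nf
      _ ≤ 2 ^ (-((j : ℝ) + 1) ^ 2) :=
          Real.rpow_le_rpow_of_exponent_le one_le_two (neg_le_neg (hC j))
      _ = 1 / 2 ^ ((j + 1) ^ 2) := by
          rw [Real.rpow_neg two_pos.le, one_div]
          exact_mod_cast congrArg _ (Real.rpow_natCast 2 ((j + 1) ^ 2))
  refine le_trans ?_ (floor_sub_le_spread_sub ht htu.le hu (j + 1))
  calc (2 : ℝ) ^ (-(C + δ + 2)) * (u - t) ^ (1 + δ)
      = (2 ^ (-(C + δ)) * (u - t) ^ δ) * (u - t) / 4 := by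
        rw [Real.rpow_add hpos, Real.rpow_one, neg_add, Real.rpow_add two_pos,
          show (2 : ℝ) ^ (-2 : ℝ) = 1 / 4 by
            rw [Real.rpow_neg two_pos.le, Real.rpow_two]; norm_num]
        ring
    _ ≤ 1 / 2 ^ ((j + 1) ^ 2) * (u - t) / 4 := by gcongr
    _ = 2 ^ ((j + 1) ^ 3) * (u - t) / 2 / 2 ^ ((j + 1) ^ 3 + (j + 1) ^ 2) / 2 := by
        rw [pow_add]
        field_simp
        norm_num
    _ ≤ _ := by gcongr

theorem exists_edist_le_mul_edist_spread_rpow {r : NNReal} (hr : 0 < r) (hr1 : r < 1) :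
    ∃ C : NNReal, ∀ t ∈ Ico (0 : ℝ) 1, ∀ u ∈ Ico (0 : ℝ) 1,
      edist t u ≤ C * edist (spread t) (spread u) ^ (r : ℝ) := by
  have hr' : (0 : ℝ) < r := hr
  have hδ : 0 < 1 / (r : ℝ) - 1 := by
    rw [sub_pos, lt_div_iff₀ hr', one_mul]
    exact hr1
  obtain ⟨c, hc, h⟩ := exists_mul_rpow_le_spread_sub hδ
  refine ⟨Real.toNNReal (c⁻¹ ^ (r : ℝ)), ?_⟩
  have key : ∀ t ∈ Ico (0 : ℝ) 1, ∀ u ∈ Ico (0 : ℝ) 1, t < u →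
      edist t u ≤ Real.toNNReal (c⁻¹ ^ (r : ℝ)) * edist (spread t) (spread u) ^ (r : ℝ) := by
    intro t ht u hu htu
    have hpos : 0 < u - t := sub_pos.mpr htu
    have h1 := h t u ht.1 htu hu.2
    rw [add_sub_cancel] at h1
    have h2 : 0 ≤ spread u - spread t := le_trans (by positivity) h1
    rw [edist_comm t, edist_comm (spread t), edist_dist, edist_dist, Real.dist_eq, Real.dist_eq,
      abs_of_pos hpos, abs_of_nonneg h2, ENNReal.ofReal_rpow_of_nonneg h2 hr'.le,
      ← ENNReal.ofReal, ← ENNReal.ofReal_mul (by positivity)]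
    refine ENNReal.ofReal_le_ofReal ?_
    rw [← Real.mul_rpow (by positivity) h2]
    calc u - t = ((u - t) ^ (1 / (r : ℝ))) ^ (r : ℝ) := by
          rw [← Real.rpow_mul hpos.le, one_div, inv_mul_cancel₀ hr'.ne', Real.rpow_one]
      _ ≤ _ := by
          gcongr
          rwa [le_inv_mul_iff₀ hc]
  intro t ht u hu
  rcases lt_trichotomy t u with htu | rfl | htu
  · exact key t ht u hu htu
  · simp
  · rw [edist_comm t, edist_comm (spread t)]
    exact key u hu t ht htu

theorem card_le_dimH_pi_of_range_spread_subset {ι : Type*} [Fintype ι] {A : Set ℝ}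
    (hA : range spread ⊆ A) :
    (Fintype.card ι : ℝ≥0∞) ≤ dimH (univ.pi fun _ : ι => A) := by
  set S : (ι → ℝ) → ι → ℝ := fun t i => spread (t i)
  set Q : Set (ι → ℝ) := univ.pi fun _ => Ico 0 1
  have hQ : dimH Q = Fintype.card ι := by
    have h : (interior Q).Nonempty := by
      rw [interior_pi_set finite_univ, univ_pi_nonempty_iff]
      simp
    rw [Real.dimH_of_nonempty_interior h, Module.finrank_fintype_fun_eq_card]
  have key : ∀ r : NNReal, 0 < r → r < 1 →
      r * (Fintype.card ι : ℝ≥0∞) ≤ dimH (univ.pi fun _ : ι => A) := by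
    intro r hr hr1
    obtain ⟨C, hC⟩ := exists_edist_le_mul_edist_spread_rpow hr hr1
    have hS : ∀ t ∈ Q, ∀ u ∈ Q, edist t u ≤ C * edist (S t) (S u) ^ (r : ℝ) := by
      intro t ht u hu
      refine edist_pi_le_iff.mpr fun i => (hC _ (ht i trivial) _ (hu i trivial)).trans ?_
      gcongr
      exact edist_le_pi_edist (S t) (S u) i
    have hinj : InjOn S Q := by
      intro t ht u hu htu
      have := hS t ht u hu
      rw [htu, edist_self, ENNReal.zero_rpow_of_pos (by exact_mod_cast hr), mul_zero] at this
      exact edist_le_zero.mp this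
    have hleft := hinj.leftInvOn_invFunOn
    have hold : HolderOnWith C r (Function.invFunOn S Q) (S '' Q) := by
      rintro _ ⟨t, ht, rfl⟩ _ ⟨u, hu, rfl⟩
      rw [hleft ht, hleft hu]
      exact hS t ht u hu
    have hdim := hold.dimH_image_le hr
    rw [hleft.image_image, hQ] at hdim
    rw [mul_comm]
    refine (ENNReal.mul_le_of_le_div hdim).trans (dimH_mono ?_)
    rintro _ ⟨t, -, rfl⟩ i -
    exact hA (mem_range_self (t i))
  rw [← one_mul (Fintype.card ι : ℝ≥0∞)]
  refine ENNReal.mul_le_of_forall_lt fun a ha b hb => ?_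
  lift a to NNReal using ha.ne_top
  rcases eq_zero_or_pos a with rfl | ha0
  · simp
  · exact (mul_le_mul_right hb.le _).trans (key a ha0 (by exact_mod_cast ha))

theorem not_essentiallyConvex_of_volume_eq_zero {d : ℕ} {E : Set (EuclideanSpace ℝ (Fin d))}
    (h0 : 0 ∈ E) (h1 : ∀ i, EuclideanSpace.single i 1 ∈ E) (hE : volume E = 0) :
    ¬ EssentiallyConvex E := by
  rintro ⟨_, -, -, L, -, hL, ⟨x, hx⟩, -⟩
  have hdir : L.direction = ⊤ := by
    rw [← top_le_iff, ← (EuclideanSpace.basisFun (Fin d) ℝ).toBasis.span_eq, Submodule.span_le]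
    rintro _ ⟨i, rfl⟩
    simpa using L.vsub_mem_direction (hL (h1 i)) (hL h0)
  have htop : L = ⊤ := (AffineSubspace.direction_eq_top_iff_of_nonempty ⟨0, hL h0⟩).mp hdir
  subst htop
  obtain ⟨V, hVE, hV, hxV⟩ := mem_interior.mp hx
  obtain ⟨U, hU, rfl⟩ := isOpen_induced_iff.mp hV
  have hUE : U ⊆ E := fun y hy => @hVE ⟨y, AffineSubspace.mem_top ℝ _ y⟩ hy
  exact (hU.measure_pos volume ⟨x, hxV⟩).ne' (measure_mono_null hUE hE)

theorem exists_fullDim_midpointConvex_not_essentiallyConvex_hausdorffMeasure_zero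
    (d : ℕ) (hd : 0 < d) :
    ∃ E : Set (EuclideanSpace ℝ (Fin d)), MeasurableSet E ∧
      dimH E = (d : ℝ≥0∞) ∧ MidpointConvexSet E ∧
      ¬ EssentiallyConvex E ∧ μH[(d : ℝ)] E = 0 := by
  set A : Set ℝ := ⋃ m, nearDyadic m
  have hAvol : volume A = 0 := measure_iUnion_null volume_nearDyadic
  have hint : ∀ n : ℤ, (n : ℝ) ∈ A := fun n =>
    mem_iUnion.mpr ⟨0, fun k => ⟨n * 2 ^ (k ^ 3 + k ^ 2), by simp⟩⟩
  set e := PiLp.continuousLinearEquiv 2 ℝ fun _ : Fin d => ℝ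
  set E : Set (EuclideanSpace ℝ (Fin d)) := e ⁻¹' univ.pi fun _ => A with hE
  have hEvol : volume E = 0 := by
    refine (PiLp.volume_preserving_ofLp (Fin d)).quasiMeasurePreserving.preimage_null ?_
    rw [volume_pi]
    exact measure_mono_null (t := Function.eval (⟨0, hd⟩ : Fin d) ⁻¹' A)
      (fun x hx => hx ⟨0, hd⟩ trivial)
      (Measure.pi_eval_preimage_null (fun _ : Fin d => volume) (i := ⟨0, hd⟩) hAvol)
  refine ⟨E, ?_, ?_, ?_, ?_, ?_⟩
  · exact e.continuous.measurable
      (.univ_pi fun _ => .iUnion measurableSet_nearDyadic)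
  · refine le_antisymm ?_ ?_
    · refine (dimH_mono (subset_univ E)).trans ?_
      rw [Real.dimH_univ_eq_finrank, finrank_euclideanSpace_fin]
    · rw [hE, e.dimH_preimage]
      refine le_trans (by simp) (card_le_dimH_pi_of_range_spread_subset (ι := Fin d) ?_)
      rintro _ ⟨t, rfl⟩
      exact mem_iUnion.mpr ⟨0, spread_mem_nearDyadic_zero t⟩
  · intro x hx y hy i _
    obtain ⟨m, hm⟩ := mem_iUnion.mp (hx i trivial)
    obtain ⟨n, hn⟩ := mem_iUnion.mp (hy i trivial)
    refine mem_iUnion.mpr ⟨max m n + 1, ?_⟩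
    have h := midpoint_mem_nearDyadic_succ (nearDyadic_mono (le_max_left m n) hm)
      (nearDyadic_mono (le_max_right m n) hn)
    simpa [midpoint_eq_smul_add, e, mul_add] using h
  · refine not_essentiallyConvex_of_volume_eq_zero (fun i _ => ?_) (fun j i _ => ?_) hEvol
    · simpa using hint 0
    · rcases eq_or_ne i j with rfl | hij
      · simpa [e] using hint 1
      · simpa [e, hij] using hint 0
  · have hH := isAddHaarMeasure_hausdorffMeasure (E := EuclideanSpace ℝ (Fin d))
    rw [finrank_euclideanSpace_fin] at hH
    exact Measure.absolutelyContinuous_isAddHaarMeasure μH[(d : ℝ)] volume hEvol
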